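/- If a graph G is k-representable for some k > 1, then for every n > 1 the Cartesian product G □ K_n is (k+n−1)-representable. -/

import Mathlib

open SimpleGraph

variable {V V' : Type*}

/-- Two letters `x` and `y` alternate in the word `w` if the word obtained from `w` by
deleting all letters other than `x` and `y` has no two consecutive equal letters. -/
def alternate [DecidableEq V] (w : List V) (x y : V) : Prop :=
  (w.filter (fun z => decide (z = x ∨ z = y))).Chain' (· ≠ ·)

/-- A word `w` over the alphabet `V` represents the graph `G`: every letter of the
alphabet occurs in `w`, and two distinct letters alternate in `w` iff they are
adjacent in `G`. -/
def represents [DecidableEq V] (G : SimpleGraph V) (w : List V) : Prop :=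
  (∀ x : V, x ∈ w) ∧ ∀ x y : V, x ≠ y → (alternate w x y ↔ G.Adj x y)

/-- A word is `k`-uniform if every letter of the alphabet occurs exactly `k` times. -/
def uniform [DecidableEq V] (k : ℕ) (w : List V) : Prop :=
  ∀ x : V, w.count x = k

/-- Label each letter with its occurrence number (`1`-based): the `i`th occurrence
of the letter `x` in `w` becomes the pair `(x, i)`. -/
def labelAux [DecidableEq V] (c : V → ℕ) : List V → List (V × ℕ)
  | [] => []
  | x :: xs => (x, c x + 1) :: labelAux (Function.update c x (c x + 1)) xs

/-- The labelled version of a word. -/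
def label [DecidableEq V] (w : List V) : List (V × ℕ) := labelAux (fun _ => 0) w

/-- `pA A w` keeps, for each letter `x`, exactly the `i`th occurrences of `x` for
`i ∈ A`, and deletes all other occurrences. -/
def pA [DecidableEq V] (A : Finset ℕ) (w : List V) : List V :=
  ((label w).filter (fun p => decide (p.2 ∈ A))).map Prod.fst

/-- Applying an occurrence-based function `h` to a word `w`: the `i`th occurrence of a
letter `x` in `w` is replaced by the string `h x i`. -/
def obf [DecidableEq V] (h : V → ℕ → List V') (w : List V) : List V' :=
  (label w).flatMap (fun p => h p.1 p.2)

/-- Replace each letter `z` of a word by `f z r`, where `r` is the number of later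
occurrences of `z`. -/
def expand {α β : Type*} [DecidableEq α] (f : α → ℕ → List β) : List α → List β
  | [] => []
  | x :: xs => f x (xs.count x) ++ expand f xs

theorem count_eq_length_filter_decide {α : Type*} [DecidableEq α] (a : α) (l : List α) :
    l.count a = (l.filter fun c => decide (c = a)).length := by
  rw [List.count_eq_length_filter]
  simp only [beq_eq_decide]

theorem mem_of_uniform {α : Type*} [DecidableEq α] {k : ℕ} {w : List α} (hk : 0 < k)
    (hw : uniform k w) (x : α) : x ∈ w :=
  List.count_pos_iff.1 (by rwa [hw x])

section Expand

variable {α β : Type*} [DecidableEq α]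

theorem expand_suffix (f : α → ℕ → List β) {u v : List α} (h : v <:+ u) :
    expand f v <:+ expand f u := by
  obtain ⟨t, rfl⟩ := h
  induction t with
  | nil => exact List.suffix_rfl
  | cons x t ih => exact ih.trans (List.suffix_append _ _)

theorem filter_expand (f : α → ℕ → List β) (P : β → Bool) (p : α → Bool)
    (hf : ∀ z r, p z = false → (f z r).filter P = []) (w : List α) :
    (expand f w).filter P = expand (fun z r => (f z r).filter P) (w.filter p) := by
  induction w with
  | nil => rfl
  | cons z w ih =>
    cases hz : p z
    · simp [expand, ih, hf z _ hz, hz]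
    · simp [expand, ih, hz, List.count_filter hz]

theorem count_expand [DecidableEq β] (f : α → ℕ → List β) (b : β) (x : α)
    (hf : ∀ z r, z ≠ x → b ∉ f z r) (w : List α) :
    (expand f w).count b = ∑ r ∈ Finset.range (w.count x), (f x r).count b := by
  induction w with
  | nil => simp [expand]
  | cons z w ih =>
    by_cases hz : z = x
    · subst hz
      simp [expand, ih, Finset.sum_range_succ, add_comm]
    · simp [expand, ih, hz, List.count_eq_zero.2 (hf z _ hz)]

theorem length_eq_count_add_count {x y : α} (hxy : x ≠ y) {u : List α}
    (hu : ∀ z ∈ u, z = x ∨ z = y) : u.length = u.count x + u.count y := by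
  induction u with
  | nil => rfl
  | cons z u ih =>
    have := ih fun c hc => hu c (by simp [hc])
    rcases hu z (by simp) with rfl | rfl <;> simp [hxy, hxy.symm] <;> omega

theorem not_isChain_expand_cons_cons {f : α → ℕ → List β} {x y : α} {a b : β}
    (hx : ∀ r, f x (r + 1) = [a]) (hy : ∀ r, f y (r + 1) = [b]) (hxy : x ≠ y) {n : ℕ}
    {v : List α} (hv : ∀ z ∈ v, z = x ∨ z = y) (hvx : v.count x = n + 2)
    (hvy : v.count y = n + 2) (h : ¬ (x :: y :: v).IsChain (· ≠ ·)) :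
    ¬ (expand f (x :: y :: v)).IsChain (· ≠ ·) ∨ ¬ v.IsChain (· ≠ ·) := by
  by_contra! hc
  obtain ⟨hc, hvc⟩ := hc
  cases v with
  | nil => simp at hvx
  | cons z t =>
    rcases hv z (by simp) with rfl | rfl
    · exact h (by simp [hxy, hxy.symm, hvc])
    · rw [List.count_cons_of_ne hxy.symm] at hvx
      rw [List.count_cons_self] at hvy
      simp [expand, hxy.symm, hvx, Nat.succ_injective hvy, hx, hy] at hc

/-- A word with `n` occurrences of each of two letters in which deleting the last
occurrences leaves an alternating word ends in a fixed pattern. -/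
theorem not_isChain_expand_or_suffix {f : α → ℕ → List β} {x y : α} {a b : β}
    (hx : ∀ r, f x (r + 1) = [a]) (hy : ∀ r, f y (r + 1) = [b]) (hxy : x ≠ y) (n : ℕ) :
    ∀ u : List α, (∀ z ∈ u, z = x ∨ z = y) → u.count x = n + 2 → u.count y = n + 2 →
      ¬ u.IsChain (· ≠ ·) →
      ¬ (expand f u).IsChain (· ≠ ·) ∨ [x, x, y, y] <:+ u ∨ [y, y, x, x] <:+ u ∨
        [x, y, y, x] <:+ u ∨ [y, x, x, y] <:+ u := by
  induction n with
  | zero =>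
    intro u hu hux huy hc
    right
    have hl : u.length = 4 := by
      rw [length_eq_count_add_count hxy hu, hux, huy]
    match u, hl with
    | [p, q, r, s], _ =>
      simp only [List.mem_cons, List.not_mem_nil, or_false, forall_eq_or_imp, forall_eq] at hu
      obtain ⟨rfl | rfl, rfl | rfl, rfl | rfl, rfl | rfl⟩ := hu <;>
        simp_all [hxy.symm]
  | succ n ih =>
    intro u hu hux huy hc
    match u with
    | [] => simp at hux
    | [p] =>
      have := List.count_le_length (a := x) (l := [p])
      simp only [List.length_singleton] at this
      omega
    | p :: q :: v =>
      have hv : ∀ z ∈ v, z = x ∨ z = y := fun z hz => hu z (by simp [hz])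
      have hsuf : v <:+ p :: q :: v := List.suffix_append [p, q] v
      have step (hvx : v.count x = n + 2) (hvy : v.count y = n + 2)
          (h : ¬ (expand f (p :: q :: v)).IsChain (· ≠ ·) ∨ ¬ v.IsChain (· ≠ ·)) :
          ¬ (expand f (p :: q :: v)).IsChain (· ≠ ·) ∨ [x, x, y, y] <:+ p :: q :: v ∨
            [y, y, x, x] <:+ p :: q :: v ∨ [x, y, y, x] <:+ p :: q :: v ∨
            [y, x, x, y] <:+ p :: q :: v := by
        rcases h with h | h
        · exact .inl h
        · exact (ih v hv hvx hvy h).imp (fun h hc => h (hc.suffix (expand_suffix f hsuf)))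
            (.imp (·.trans hsuf) <| .imp (·.trans hsuf) <| .imp (·.trans hsuf) (·.trans hsuf))
      rcases hu p (by simp) with rfl | rfl <;> rcases hu q (by simp) with rfl | rfl
      · have h : v.count q = n + 1 := by simpa using hux
        left
        simp [expand, h, hx]
      · have h1 : v.count p = n + 2 := by simpa [hxy.symm] using hux
        have h2 : v.count q = n + 2 := by simpa [hxy] using huy
        exact step h1 h2 (not_isChain_expand_cons_cons hx hy hxy hv h1 h2 hc)
      · have h1 : v.count q = n + 2 := by simpa [hxy.symm] using hux
        have h2 : v.count p = n + 2 := by simpa [hxy] using huy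
        exact step h1 h2 (not_isChain_expand_cons_cons hy hx hxy.symm
          (fun z hz => (hv z hz).symm) h2 h1 hc)
      · have h : v.count q = n + 1 := by simpa using huy
        left
        simp [expand, h, hy]

end Expand

/-- `Zigzag p q r s l` says that `l` is an initial segment of the periodic word
`p, q, p, q, …`, after which the periodic word continues as `r, s, r, s, …`. -/
inductive Zigzag {α : Type*} : α → α → α → α → List α → Prop
  | nil (p q : α) : Zigzag p q p q []
  | cons {p q r s : α} {l : List α} : Zigzag q p r s l → Zigzag p q r s (p :: l)

namespace Zigzag

variable {α : Type*}

theorem append {p q r s t v : α} {l l' : List α} (h : Zigzag p q r s l)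
    (h' : Zigzag r s t v l') : Zigzag p q t v (l ++ l') := by
  induction h with
  | nil => exact h'
  | cons _ ih => exact (ih h').cons

theorem pair (p q : α) : Zigzag p q p q [p, q] := .cons (.cons (.nil _ _))

theorem flatMap {ι : Type*} {p q : α} (l : List ι) (f : ι → List α)
    (h : ∀ i ∈ l, Zigzag p q p q (f i)) : Zigzag p q p q (l.flatMap f) := by
  induction l with
  | nil => exact .nil _ _
  | cons i l ih =>
    rw [List.flatMap_cons]
    exact (h i (by simp)).append (ih fun j hj => h j (by simp [hj]))

theorem isChain {p q r s : α} {l : List α} (h : Zigzag p q r s l) (hpq : p ≠ q) :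
    l.IsChain (· ≠ ·) := by
  suffices H : l.IsChain (· ≠ ·) ∧ ∀ c ∈ l.head?, c = p from H.1
  induction h with
  | nil => simp
  | cons _ ih =>
    obtain ⟨h1, h2⟩ := ih hpq.symm
    refine ⟨List.isChain_cons.2 ⟨fun c hc => ?_, h1⟩, by simp⟩
    rw [h2 c hc]
    exact hpq

end Zigzag

/-- The alternating word `x y x y …` of length `2 n`. -/
def altWord {α : Type*} (x y : α) : ℕ → List α
  | 0 => []
  | n + 1 => x :: y :: altWord x y n

theorem altWord_suffix {α : Type*} (x y : α) (n : ℕ) : [x, y, x, y] <:+ altWord x y (n + 2) := by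
  induction n with
  | zero => exact List.suffix_rfl
  | succ n ih => exact ih.trans (List.suffix_append [x, y] _)

section AltWord

variable {α β : Type*} [DecidableEq α]

theorem count_altWord {x y : α} (hxy : x ≠ y) (n : ℕ) :
    (altWord x y n).count x = n ∧ (altWord x y n).count y = n := by
  induction n with
  | zero => simp [altWord]
  | succ n ih => simp [altWord, ih, hxy, hxy.symm]

theorem eq_altWord_of_head {x y : α} (hxy : x ≠ y) (n : ℕ) :
    ∀ u : List α, (∀ z ∈ u, z = x ∨ z = y) → u.count x = n → u.count y = n →
      u.IsChain (· ≠ ·) → (∀ c ∈ u.head?, c = x) → u = altWord x y n := by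
  induction n with
  | zero =>
    intro u hu hx hy _ _
    cases u with
    | nil => rfl
    | cons z u => rcases hu z (by simp) with rfl | rfl <;> simp at hx hy
  | succ n ih =>
    intro u hu hx hy hc hh
    match u with
    | [] => simp at hx
    | [p] => simp_all
    | p :: q :: v =>
      obtain rfl : p = x := hh p (by simp)
      obtain ⟨hpq, hc⟩ := List.isChain_cons_cons.1 hc
      obtain rfl : q = y := (hu q (by simp)).resolve_left hpq.symm
      have hv : ∀ z ∈ v, z = p ∨ z = q := fun z hz => hu z (by simp [hz])
      rw [altWord, ih v hv (by simpa [hxy.symm] using hx) (by simpa [hxy] using hy) hc.tail]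
      intro c hcv
      exact (hv c (List.mem_of_mem_head? hcv)).resolve_right
        ((List.isChain_cons.1 hc).1 c hcv).symm

theorem eq_altWord {x y : α} (hxy : x ≠ y) {n : ℕ} {u : List α}
    (hu : ∀ z ∈ u, z = x ∨ z = y) (hx : u.count x = n) (hy : u.count y = n)
    (h : u.IsChain (· ≠ ·)) : u = altWord x y n ∨ u = altWord y x n := by
  cases u with
  | nil => left; exact eq_altWord_of_head hxy n _ hu hx hy h (by simp)
  | cons z u =>
    rcases hu z (by simp) with rfl | rfl
    · left; exact eq_altWord_of_head hxy n _ hu hx hy h (by simp)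
    · right; exact eq_altWord_of_head hxy.symm n _ (fun c hc => (hu c hc).symm) hy hx h (by simp)

theorem zigzag_expand_altWord {f : α → ℕ → List β} {x y : α} {a b : β} (hxy : x ≠ y)
    (hf : ∀ r, (f x r = [] ∧ f y r = []) ∨ (f x r = [a] ∧ f y r = [b])) (n : ℕ) :
    Zigzag a b a b (expand f (altWord x y n)) := by
  induction n with
  | zero => exact .nil _ _
  | succ n ih =>
    have h := count_altWord hxy n
    simp only [altWord, expand, List.count_cons_of_ne hxy.symm, h.1, h.2]
    rcases hf n with h | h
    · simpa [h.1, h.2] using ih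
    · simpa [h.1, h.2] using (Zigzag.pair a b).append ih

theorem zigzag_expand_replicate {f : α → ℕ → List β} {x : α} {a b c d : β}
    (h : ∀ r, f x (r + 1) = [] ∨ f x (r + 1) = [a, b]) (h0 : Zigzag a b c d (f x 0)) (n : ℕ) :
    Zigzag a b c d (expand f (List.replicate (n + 1) x)) := by
  induction n with
  | zero => simpa [expand] using h0
  | succ n ih =>
    rw [List.replicate_succ, expand, List.count_replicate_self]
    rcases h n with h | h <;> rw [h]
    · exact ih
    · exact (Zigzag.pair a b).append ih

end AltWord

/-- The elements of `Fin n` in cyclically decreasing order, starting from `m`. -/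
def cyclicDesc {n : ℕ} (m : Fin n) : List (Fin n) :=
  (List.finRange n).reverse.filter (· ≤ m) ++
    (List.finRange n).reverse.filter (fun c => ! decide (c ≤ m))

theorem count_cyclicDesc {n : ℕ} (m i : Fin n) : (cyclicDesc m).count i = 1 := by
  rw [cyclicDesc, (List.filter_append_perm _ _).count_eq, List.count_reverse]
  exact List.count_eq_one_of_mem (List.nodup_finRange n) (List.mem_finRange i)

theorem filter_cyclicDesc_eq {n : ℕ} (m i : Fin n) :
    (cyclicDesc m).filter (fun c => decide (c = i)) = [i] := by
  have := List.filter_eq (l := cyclicDesc m) i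
  simp_all [count_cyclicDesc, eq_comm]

theorem filter_reverse_finRange_pair {n : ℕ} {i j : Fin n} (h : j < i) :
    (List.finRange n).reverse.filter (fun c => decide (c = i ∨ c = j)) = [i, j] := by
  refine List.Perm.eq_of_pairwise' (r := (· > ·)) ?_ (by simpa using h) ?_
  · exact (List.pairwise_reverse.2 (List.pairwise_lt_finRange n)).filter _
  · refine (List.perm_ext_iff_of_nodup ?_ (by simpa using h.ne')).2 fun c => by simp
    exact (List.nodup_reverse.2 (List.nodup_finRange n)).filter _

theorem filter_cyclicDesc_pair {n : ℕ} (m : Fin n) {i j : Fin n} (h : j < i) :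
    (cyclicDesc m).filter (fun c => decide (c = i ∨ c = j)) =
      if j ≤ m ∧ m < i then [j, i] else [i, j] := by
  rw [cyclicDesc, List.filter_append, List.filter_filter, List.filter_filter]
  simp only [Bool.and_comm (decide (_ ∨ _))]
  rw [← List.filter_filter, ← List.filter_filter, filter_reverse_finRange_pair h]
  by_cases h1 : i ≤ m <;> by_cases h2 : j ≤ m <;> simp [h1, h2]

/-- The string substituted in stage `m` for an occurrence of `z` with `r` later ones. -/
def stage {V : Type*} {n : ℕ} (m : Fin (n + 1)) (z : V) (r : ℕ) : List (V × Fin (n + 1)) :=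
  (if r = 0 then [m] else if r = 1 ∨ m = Fin.last n then cyclicDesc m else []).map (Prod.mk z)

/-- The word representing the product with a complete graph. -/
def prodWord {V : Type*} [DecidableEq V] (n : ℕ) (w : List V) : List (V × Fin (n + 1)) :=
  (List.finRange (n + 1)).reverse.flatMap fun m => expand (stage m) w

section Stage

variable {V : Type*} {n : ℕ}

theorem filter_stage {x : V} {i : Fin (n + 1)} {P : V × Fin (n + 1) → Bool}
    (hP : ∀ c, P (x, c) = decide (c = i)) (m : Fin (n + 1)) (r : ℕ) :
    (stage m x r).filter P =
      if r = 0 ∧ m = i ∨ r = 1 ∨ 1 < r ∧ m = Fin.last n then [(x, i)] else [] := by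
  have hP' : P ∘ Prod.mk x = fun c => decide (c = i) := funext hP
  rw [stage, List.filter_map, hP']
  obtain rfl | rfl | hr : r = 0 ∨ r = 1 ∨ 1 < r := by omega
  · by_cases h : m = i <;> simp [h]
  · simp [filter_cyclicDesc_eq]
  · by_cases h : m = Fin.last n <;>
      simp [h, hr, hr.ne', (zero_lt_one.trans hr).ne', filter_cyclicDesc_eq]

theorem filter_stage_of_ne {x y z : V} {i j : Fin (n + 1)} [DecidableEq V] (hx : z ≠ x)
    (hy : z ≠ y) (m : Fin (n + 1)) (r : ℕ) :
    (stage m z r).filter (fun v => decide (v = (x, i) ∨ v = (y, j))) = [] := by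
  rw [stage, List.filter_map]
  simp [Function.comp_def, hx, hy]

theorem filter_stage_pair [DecidableEq V] (x : V) {i j : Fin (n + 1)} (h : j < i)
    (m : Fin (n + 1)) (r : ℕ) :
    (stage m x r).filter (fun v => decide (v = (x, i) ∨ v = (x, j))) =
      (if r = 0 then if m = i ∨ m = j then [m] else []
        else if r = 1 ∨ m = Fin.last n then
          if j ≤ m ∧ m < i then [j, i] else [i, j]
        else []).map (Prod.mk x) := by
  rw [stage, List.filter_map]
  congr 1
  simp only [Function.comp_def, Prod.mk.injEq, true_and]
  rw [apply_ite (List.filter _), apply_ite (List.filter _), filter_cyclicDesc_pair m h]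
  simp [List.filter_cons]

variable [DecidableEq V]

theorem count_stage (m : Fin (n + 1)) (x : V) (i : Fin (n + 1)) (r : ℕ) :
    @List.count _ instBEqOfDecidableEq (x, i) (stage m x r) =
      if r = 0 ∧ m = i ∨ r = 1 ∨ 1 < r ∧ m = Fin.last n then 1 else 0 := by
  rw [count_eq_length_filter_decide, filter_stage (x := x) (i := i) (by simp)]
  split_ifs <;> rfl

theorem uniform_prodWord {k : ℕ} {w : List V} (hw : uniform (k + 2) w) :
    uniform (k + 2 + n) (prodWord n w) := by
  rintro ⟨x, i⟩
  have h (m : Fin (n + 1)) : @List.count _ instBEqOfDecidableEq (x, i) (expand (stage m) w) =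
      (if m = i then 1 else 0) + 1 + if m = Fin.last n then k else 0 := by
    rw [count_expand _ _ x (fun z r hz => by simp [stage, hz]), hw x, Finset.sum_range_succ',
      Finset.sum_range_succ']
    simp only [count_stage]
    split_ifs <;> simp_all <;> omega
  rw [prodWord, @List.count_flatMap _ _ instBEqOfDecidableEq, List.map_reverse, List.sum_reverse]
  simp only [Function.comp_def, h]
  rw [← List.ofFn_eq_map, List.sum_ofFn]
  simp [Finset.sum_add_distrib]
  omega

theorem alternate_comm (w : List V) (x y : V) : alternate w x y ↔ alternate w y x := by
  simp only [alternate, or_comm]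

theorem filter_prodWord {x y : V} (i j : Fin (n + 1)) (w : List V) :
    (prodWord n w).filter (fun v => decide (v = (x, i) ∨ v = (y, j))) =
      (List.finRange (n + 1)).reverse.flatMap fun m =>
        expand (fun z r => (stage m z r).filter (fun v => decide (v = (x, i) ∨ v = (y, j))))
          (w.filter fun z => decide (z = x ∨ z = y)) := by
  rw [prodWord, List.filter_flatMap]
  congr 1
  funext m
  refine filter_expand _ _ _ (fun z r hz => ?_) w
  simp only [decide_eq_false_iff_not, not_or] at hz
  exact filter_stage_of_ne hz.1 hz.2 m r

theorem alternate_prodWord_self {x : V} {i j : Fin (n + 1)} (h : j < i) {k : ℕ} {w : List V}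
    (hw : w.count x = k + 1) : alternate (prodWord n w) (x, i) (x, j) := by
  obtain ⟨l₁, l₂, hl⟩ := List.append_of_mem
    (List.mem_reverse.2 (List.mem_finRange i))
  have hp := List.pairwise_reverse.2 (List.pairwise_lt_finRange (n + 1))
  rw [hl, List.pairwise_append, List.pairwise_cons] at hp
  obtain ⟨-, ⟨hi, hp⟩, hl₁⟩ := hp
  have hj : j ∈ l₂ := by
    have := List.mem_reverse.2 (List.mem_finRange j)
    rw [hl] at this
    rcases List.mem_append.1 this with h' | h'
    · exact absurd (hl₁ j h' i (by simp)) h.not_gt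
    · exact (List.mem_cons.1 h').resolve_left h.ne
  obtain ⟨l₃, l₄, rfl⟩ := List.append_of_mem hj
  rw [List.pairwise_append, List.pairwise_cons] at hp
  obtain ⟨-, ⟨hj', -⟩, hl₃⟩ := hp
  unfold alternate
  rw [filter_prodWord, hl]
  have hu : (w.filter fun z => decide (z = x ∨ z = x)) = List.replicate (k + 1) x := by
    simp only [or_self, ← hw, ← List.filter_beq, beq_eq_decide]
  rw [hu]
  have hab : (x, i) ≠ (x, j) := by simpa using h.ne'
  refine Zigzag.isChain (r := (x, i)) (s := (x, j)) ?_ hab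
  simp only [List.flatMap_append, List.flatMap_cons]
  refine .append (r := (x, i)) (s := (x, j)) (.flatMap _ _ fun m hm => ?_) <|
    .append (r := (x, j)) (s := (x, i)) ?_ <|
    .append (r := (x, j)) (s := (x, i)) (.flatMap _ _ fun m hm => ?_) <|
    .append (r := (x, i)) (s := (x, j)) ?_ (.flatMap _ _ fun m hm => ?_)
  · have hm : i < m := hl₁ m hm i (by simp)
    apply zigzag_expand_replicate
    · intro r
      simp only [filter_stage_pair x h]
      simp [hm.not_gt]
      split_ifs <;> simp_all
    · simp only [filter_stage_pair x h]
      simpa [hm.ne', (h.trans hm).ne'] using Zigzag.nil _ _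
  · apply zigzag_expand_replicate
    · intro r
      simp only [filter_stage_pair x h]
      simp
      split_ifs <;> simp_all
    · simp only [filter_stage_pair x h]
      simpa using Zigzag.cons (Zigzag.nil _ _)
  · have h1 : m < i := hi m (by simp [hm])
    have h2 : j < m := hl₃ m hm j (by simp)
    apply zigzag_expand_replicate
    · intro r
      simp only [filter_stage_pair x h]
      simp [h1, h2.le]
      split_ifs <;> simp_all
    · simp only [filter_stage_pair x h]
      simpa [h1.ne, h2.ne'] using Zigzag.nil _ _
  · apply zigzag_expand_replicate
    · intro r
      simp only [filter_stage_pair x h]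
      simp [h]
      split_ifs <;> simp_all
    · simp only [filter_stage_pair x h]
      simpa using Zigzag.cons (Zigzag.nil _ _)
  · have h1 : m < j := hj' m hm
    apply zigzag_expand_replicate
    · intro r
      simp only [filter_stage_pair x h]
      simp [h1.not_ge]
      split_ifs <;> simp_all
    · simp only [filter_stage_pair x h]
      simpa [h1.ne, (h1.trans h).ne] using Zigzag.nil _ _

theorem alternate_prodWord_of_ne {x y : V} (hxy : x ≠ y) (i j : Fin (n + 1)) {k : ℕ}
    {w : List V} (hw : uniform (k + 2) w) :
    alternate (prodWord n w) (x, i) (y, j) ↔ alternate w x y ∧ i = j := by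
  set u := w.filter fun z => decide (z = x ∨ z = y) with hu_def
  have hu : ∀ z ∈ u, z = x ∨ z = y := fun z hz => by simpa [hu_def] using (List.mem_filter.1 hz).2
  have hux : u.count x = k + 2 := by rw [hu_def, List.count_filter (by simp), hw]
  have huy : u.count y = k + 2 := by rw [hu_def, List.count_filter (by simp), hw]
  have hw' : alternate w x y ↔ u.IsChain (· ≠ ·) := Iff.rfl
  rw [hw']
  unfold alternate
  rw [filter_prodWord, ← hu_def]
  set g : Fin (n + 1) → V → ℕ → List (V × Fin (n + 1)) := fun m z r =>
    (stage m z r).filter (fun v => decide (v = (x, i) ∨ v = (y, j))) with hg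
  have hgx (m r) : g m x r =
      if r = 0 ∧ m = i ∨ r = 1 ∨ 1 < r ∧ m = Fin.last n then [(x, i)] else [] :=
    filter_stage (by simp [hxy]) m r
  have hgy (m r) : g m y r =
      if r = 0 ∧ m = j ∨ r = 1 ∨ 1 < r ∧ m = Fin.last n then [(y, j)] else [] :=
    filter_stage (by simp [hxy.symm]) m r
  constructor
  · intro h
    have hc (m : Fin (n + 1)) {v : List V} (hv : v <:+ u) :
        (expand (g m) v).IsChain (· ≠ ·) := by
      obtain ⟨s, t, hst⟩ := List.infix_of_mem_flatten (List.mem_map_of_mem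
        (f := fun m => expand (g m) u) (List.mem_reverse.2 (List.mem_finRange m)))
      rw [List.flatMap_def, ← hst] at h
      exact h.left_of_append.right_of_append.suffix (expand_suffix _ hv)
    have huc : u.IsChain (· ≠ ·) := by
      by_contra huc
      rcases not_isChain_expand_or_suffix (f := g (Fin.last n)) (a := (x, i)) (b := (y, j))
        (by intro r; rw [hgx, if_pos]; simp; omega) (by intro r; rw [hgy, if_pos]; simp; omega)
        hxy k u hu hux huy huc with h' | h' | h' | h' | h'
      · exact h' (hc _ List.suffix_rfl)
      · simpa [expand, hgx, hgy, hxy, hxy.symm] using hc i h'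
      · simpa [expand, hgx, hgy, hxy, hxy.symm] using hc j h'
      · simpa [expand, hgx, hgy, hxy, hxy.symm] using hc j h'
      · simpa [expand, hgx, hgy, hxy, hxy.symm] using hc i h'
    refine ⟨huc, ?_⟩
    by_contra hij
    rcases eq_altWord hxy hu hux huy huc with h' | h'
    · have := hc j (h' ▸ altWord_suffix x y k)
      simp [expand, hgx, hgy, hxy, hxy.symm, Ne.symm hij] at this
    · have := hc i (h' ▸ altWord_suffix y x k)
      simp [expand, hgx, hgy, hxy, hxy.symm, hij] at this
  · rintro ⟨huc, rfl⟩
    have hne : (x, i) ≠ (y, i) := by simp [hxy]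
    rcases eq_altWord hxy hu hux huy huc with h' | h' <;> rw [h']
    · refine (Zigzag.flatMap _ _ fun m _ => zigzag_expand_altWord hxy ?_ _).isChain hne
      intro r
      change (g m x r = [] ∧ g m y r = []) ∨ (g m x r = _ ∧ g m y r = _)
      rw [hgx, hgy]
      split_ifs <;> simp
    · refine (Zigzag.flatMap _ _ fun m _ => zigzag_expand_altWord hxy.symm ?_ _).isChain hne.symm
      intro r
      change (g m y r = [] ∧ g m x r = []) ∨ (g m y r = _ ∧ g m x r = _)
      rw [hgx, hgy]
      split_ifs <;> simp

end Stage

theorem stmt10 {V : Type*} [DecidableEq V] (G : SimpleGraph V) (k n : ℕ)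
    (hk : 1 < k) (hn : 1 < n) (hG : ∃ w : List V, uniform k w ∧ represents G w) :
    ∃ w' : List (V × Fin n), uniform (k + n - 1) w' ∧
      represents (G □ (⊤ : SimpleGraph (Fin n))) w' := by
  obtain ⟨w, hw, -, hrep⟩ := hG
  obtain ⟨k, rfl⟩ := Nat.exists_eq_add_of_le' hk
  obtain ⟨n, rfl⟩ := Nat.exists_eq_add_of_lt hn
  have hw' := uniform_prodWord (n := 1 + n) hw
  refine ⟨prodWord (1 + n) w, hw', mem_of_uniform (by omega) hw', ?_⟩
  rintro ⟨x, i⟩ ⟨y, j⟩ hne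
  rw [boxProd_adj, top_adj]
  by_cases hxy : x = y
  · subst hxy
    have hij : i ≠ j := by simpa using hne
    simp only [SimpleGraph.irrefl, false_and, false_or, ne_eq, hij, not_false_eq_true, and_true,
      iff_true]
    rcases hij.lt_or_gt with h | h
    · exact (alternate_comm _ _ _).1 (alternate_prodWord_self h (hw x))
    · exact alternate_prodWord_self h (hw x)
  · rw [alternate_prodWord_of_ne hxy i j hw, hrep x y hxy]
    simp [hxy]
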